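/- Correctness of Marsaglia's method for n = 3: if (a, b) is uniformly distributed on the unit disk {(a,b) : a² + b² ≤ 1} and S = a² + b², then the random vector ( a·√((1−(1−2S)²)/S), b·√((1−(1−2S)²)/S), 1−2S ) is uniformly distributed on the unit sphere S² ⊂ ℝ³. -/

import Mathlib

open MeasureTheory ProbabilityTheory Metric

/-- A measure is the uniform distribution on the unit sphere of a real inner product
space iff it is a (rotation-invariant) Borel probability measure concentrated on the
unit sphere that is invariant under every linear isometry. -/
def IsUniformSphere {E : Type*} [NormedAddCommGroup E] [InnerProductSpace ℝ E]
    [MeasurableSpace E] [BorelSpace E] (μ : Measure E) : Prop :=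
  IsProbabilityMeasure μ ∧ μ (Metric.sphere (0 : E) 1)ᶜ = 0 ∧
    ∀ e : E ≃ₗᵢ[ℝ] E, μ.map e = μ

/-- The uniform distribution on the closed unit ball of `ℝⁿ`:
normalized Lebesgue measure restricted to the ball. -/
noncomputable def uniformBall (n : ℕ) : Measure (EuclideanSpace ℝ (Fin n)) :=
  (volume (Metric.closedBall (0 : EuclideanSpace ℝ (Fin n)) 1))⁻¹ •
    volume.restrict (Metric.closedBall (0 : EuclideanSpace ℝ (Fin n)) 1)

/-- The area-preserving (up to a factor) parametrization of the unit sphere by the unit disk. -/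
noncomputable def diskToSphere (p : EuclideanSpace ℝ (Fin 2)) : EuclideanSpace ℝ (Fin 3) :=
  !₂[2 * p 0 * √(1 - (p 0 ^ 2 + p 1 ^ 2)), 2 * p 1 * √(1 - (p 0 ^ 2 + p 1 ^ 2)),
    1 - 2 * (p 0 ^ 2 + p 1 ^ 2)]

lemma measurable_diskToSphere : Measurable diskToSphere := by
  refine Continuous.measurable ?_
  unfold diskToSphere
  fun_prop

lemma sq_add_sq_lt_one_of_mem_ball {p : EuclideanSpace ℝ (Fin 2)} (hp : p ∈ ball 0 1) :
    p 0 ^ 2 + p 1 ^ 2 < 1 := by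
  rw [mem_ball_zero_iff, ← sq_lt_one_iff₀ (norm_nonneg p), EuclideanSpace.real_norm_sq_eq,
    Fin.sum_univ_two] at hp
  exact hp

lemma norm_diskToSphere {p : EuclideanSpace ℝ (Fin 2)} (hp : p ∈ ball 0 1) :
    ‖diskToSphere p‖ = 1 := by
  have h := sq_add_sq_lt_one_of_mem_ball hp
  rw [← pow_eq_one_iff_of_nonneg (norm_nonneg _) two_ne_zero, EuclideanSpace.real_norm_sq_eq,
    Fin.sum_univ_three]
  simp only [diskToSphere, PiLp.toLp_apply, Matrix.cons_val, mul_pow]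
  rw [Real.sq_sqrt (by linarith)]
  ring

/-- Spherical coordinates on the unit ball: the first coordinate is the radius, the other two
parametrize the sphere through `diskToSphere`. -/
noncomputable def diskCone (v : Fin 3 → ℝ) : Fin 3 → ℝ :=
  ![2 * v 0 * v 1 * √(1 - (v 1 ^ 2 + v 2 ^ 2)), 2 * v 0 * v 2 * √(1 - (v 1 ^ 2 + v 2 ^ 2)),
    v 0 * (1 - 2 * (v 1 ^ 2 + v 2 ^ 2))]

lemma toLp_diskCone (v : Fin 3 → ℝ) :
    WithLp.toLp 2 (diskCone v) = v 0 • diskToSphere (!₂[v 1, v 2]) := by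
  ext i
  fin_cases i <;> simp [diskCone, diskToSphere] <;> ring

/-- The Jacobian matrix of `diskCone`. -/
noncomputable def diskConeJacobian (v : Fin 3 → ℝ) : Matrix (Fin 3) (Fin 3) ℝ :=
  let c := √(1 - (v 1 ^ 2 + v 2 ^ 2))
  !![2 * v 1 * c, 2 * v 0 * (c - v 1 ^ 2 / c), -(2 * v 0 * v 1 * v 2 / c);
    2 * v 2 * c, -(2 * v 0 * v 1 * v 2 / c), 2 * v 0 * (c - v 2 ^ 2 / c);
    1 - 2 * (v 1 ^ 2 + v 2 ^ 2), -(4 * v 0 * v 1), -(4 * v 0 * v 2)]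

lemma det_diskConeJacobian {v : Fin 3 → ℝ} (hv : v 1 ^ 2 + v 2 ^ 2 < 1) :
    (diskConeJacobian v).det = 4 * v 0 ^ 2 := by
  have hc : √(1 - (v 1 ^ 2 + v 2 ^ 2)) ≠ 0 := (Real.sqrt_pos.2 (by linarith)).ne'
  have hc2 : √(1 - (v 1 ^ 2 + v 2 ^ 2)) ^ 2 = 1 - (v 1 ^ 2 + v 2 ^ 2) :=
    Real.sq_sqrt (by linarith)
  simp only [Matrix.det_fin_three, diskConeJacobian, Matrix.of_apply, Matrix.cons_val]
  generalize √(1 - (v 1 ^ 2 + v 2 ^ 2)) = c at hc hc2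
  have h2 : v 2 ^ 2 = 1 - c ^ 2 - v 1 ^ 2 := by linarith
  field_simp
  grind

lemma hasFDerivAt_diskCone {v : Fin 3 → ℝ} (hv : v 1 ^ 2 + v 2 ^ 2 < 1) :
    HasFDerivAt diskCone
      (LinearMap.toContinuousLinearMap (Matrix.toLin' (diskConeJacobian v))) v := by
  have hne : 1 - (v 1 ^ 2 + v 2 ^ 2) ≠ 0 := by linarith
  have hc : √(1 - (v 1 ^ 2 + v 2 ^ 2)) ≠ 0 := (Real.sqrt_pos.2 (by linarith)).ne'
  have h0 := hasFDerivAt_apply (𝕜 := ℝ) (F' := fun _ : Fin 3 => ℝ) 0 v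
  have h1 := hasFDerivAt_apply (𝕜 := ℝ) (F' := fun _ : Fin 3 => ℝ) 1 v
  have h2 := hasFDerivAt_apply (𝕜 := ℝ) (F' := fun _ : Fin 3 => ℝ) 2 v
  have hS := (h1.pow 2).add (h2.pow 2)
  have hsqrt := (hS.const_sub 1).sqrt hne
  rw [hasFDerivAt_pi']
  intro i
  fin_cases i
  · refine ((((h0.const_mul 2).mul h1).mul hsqrt)).congr_fderiv ?_
    ext j
    simp [diskConeJacobian, Matrix.toLin'_apply, dotProduct, Fin.sum_univ_three]
    field_simp
    ring
  · refine ((((h0.const_mul 2).mul h2).mul hsqrt)).congr_fderiv ?_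
    ext j
    simp [diskConeJacobian, Matrix.toLin'_apply, dotProduct, Fin.sum_univ_three]
    field_simp
    ring
  · refine (h0.mul ((hS.const_mul 2).const_sub 1)).congr_fderiv ?_
    ext j
    simp [diskConeJacobian, Matrix.toLin'_apply, dotProduct, Fin.sum_univ_three]
    ring

/-- The set of `v : Fin 3 → ℝ` with `v 0 ∈ (0, 1)` and `(v 1, v 2) ∈ B`. -/
def cylinderOver (B : Set (EuclideanSpace ℝ (Fin 2))) : Set (Fin 3 → ℝ) :=
  {v | v 0 ∈ Set.Ioo 0 1 ∧ !₂[v 1, v 2] ∈ B}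

lemma measurableSet_cylinderOver {B : Set (EuclideanSpace ℝ (Fin 2))} (hB : MeasurableSet B) :
    MeasurableSet (cylinderOver B) := by
  refine ((measurable_pi_apply 0) measurableSet_Ioo).inter (?_ : MeasurableSet
    ((fun v : Fin 3 → ℝ => !₂[v 1, v 2]) ⁻¹' B))
  refine Continuous.measurable ?_ hB
  fun_prop

lemma sq_add_sq_lt_one_of_mem_cylinderOver {B : Set (EuclideanSpace ℝ (Fin 2))}
    (hB : B ⊆ ball 0 1) {v : Fin 3 → ℝ} (hv : v ∈ cylinderOver B) : v 1 ^ 2 + v 2 ^ 2 < 1 := by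
  simpa using sq_add_sq_lt_one_of_mem_ball (hB hv.2)

lemma injOn_diskCone {B : Set (EuclideanSpace ℝ (Fin 2))} (hB : B ⊆ ball 0 1) :
    Set.InjOn diskCone (cylinderOver B) := by
  intro v hv w hw h
  have hSv := sq_add_sq_lt_one_of_mem_cylinderOver hB hv
  have hLp := congrArg (WithLp.toLp 2) h
  rw [toLp_diskCone, toLp_diskCone] at hLp
  have h0 : v 0 = w 0 := by
    have := congrArg norm hLp
    rwa [norm_smul, norm_smul, norm_diskToSphere (hB hv.2), norm_diskToSphere (hB hw.2), mul_one,
      mul_one, Real.norm_of_nonneg hv.1.1.le, Real.norm_of_nonneg hw.1.1.le] at this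
  rw [h0] at hLp
  have hT := smul_right_injective _ hw.1.1.ne' hLp
  have t0 := congrArg (fun x : EuclideanSpace ℝ (Fin 3) => x 0) hT
  have t1 := congrArg (fun x : EuclideanSpace ℝ (Fin 3) => x 1) hT
  have t2 := congrArg (fun x : EuclideanSpace ℝ (Fin 3) => x 2) hT
  simp only [diskToSphere, PiLp.toLp_apply, Matrix.cons_val] at t0 t1 t2
  have hS : w 1 ^ 2 + w 2 ^ 2 = v 1 ^ 2 + v 2 ^ 2 := by linarith
  rw [hS] at t0 t1
  have hc : √(1 - (v 1 ^ 2 + v 2 ^ 2)) ≠ 0 := (Real.sqrt_pos.2 (by linarith)).ne'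
  have e1 := mul_right_cancel₀ hc t0
  have e2 := mul_right_cancel₀ hc t1
  ext i
  fin_cases i
  · exact h0
  · simpa using e1
  · simpa using e2

lemma lintegral_cylinderOver {B : Set (EuclideanSpace ℝ (Fin 2))} (hB : MeasurableSet B) :
    ∫⁻ v in cylinderOver B, ENNReal.ofReal (4 * v 0 ^ 2) =
      ENNReal.ofReal (4 / 3) * volume B := by
  have hpre : cylinderOver B = MeasurableEquiv.piFinSuccAbove (fun _ : Fin 3 => ℝ) 0 ⁻¹'
      (Set.Ioo 0 1 ×ˢ (WithLp.toLp 2 ⁻¹' B)) := by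
    ext v
    have : (WithLp.toLp 2 (fun j : Fin 2 => v j.succ)) = !₂[v 1, v 2] := by
      ext j
      fin_cases j <;> rfl
    simp [cylinderOver, MeasurableEquiv.piFinSuccAbove, Fin.insertNthEquiv, ← this]
    intros
    rfl
  have hmp := volume_preserving_piFinSuccAbove (fun _ : Fin 3 => ℝ) 0
  have h := hmp.setLIntegral_comp_preimage_emb (MeasurableEquiv.measurableEmbedding _)
    (fun z => ENNReal.ofReal (4 * z.1 ^ 2)) (Set.Ioo 0 1 ×ˢ (WithLp.toLp 2 ⁻¹' B))
  rw [hpre]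
  refine h.trans ?_
  rw [Measure.volume_eq_prod, ← Measure.prod_restrict]
  have hp := lintegral_prod_mul (μ := (volume : Measure ℝ).restrict (Set.Ioo 0 1))
    (ν := (volume : Measure (Fin 2 → ℝ)).restrict (WithLp.toLp 2 ⁻¹' B))
    (f := fun x => ENNReal.ofReal (4 * x ^ 2)) (g := fun _ => 1) (by fun_prop) (by fun_prop)
  simp only [mul_one, lintegral_const, one_mul, Measure.restrict_apply_univ] at hp
  refine hp.trans ?_
  rw [(PiLp.volume_preserving_toLp (Fin 2)).measure_preimage hB.nullMeasurableSet]
  congr 1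
  rw [← ofReal_integral_eq_lintegral_ofReal, ← integral_Ioc_eq_integral_Ioo,
    ← intervalIntegral.integral_of_le zero_le_one]
  · congr 1
    simp
    norm_num
  · exact ((by fun_prop : Continuous fun x : ℝ => 4 * x ^ 2).integrableOn_Icc
      (a := 0) (b := 1)).mono_set Set.Ioo_subset_Icc_self
  · exact Filter.Eventually.of_forall fun x => by positivity

lemma volume_image_diskCone {B : Set (EuclideanSpace ℝ (Fin 2))} (hB : MeasurableSet B)
    (hB1 : B ⊆ ball 0 1) :
    volume (diskCone '' cylinderOver B) = ENNReal.ofReal (4 / 3) * volume B := by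
  rw [← lintegral_cylinderOver hB, ← lintegral_abs_det_fderiv_eq_addHaar_image volume
    (measurableSet_cylinderOver hB) (fun v hv => (hasFDerivAt_diskCone
      (sq_add_sq_lt_one_of_mem_cylinderOver hB1 hv)).hasFDerivWithinAt) (injOn_diskCone hB1)]
  refine setLIntegral_congr_fun (measurableSet_cylinderOver hB) fun v hv => ?_
  rw [LinearMap.det_toContinuousLinearMap, LinearMap.det_toLin',
    det_diskConeJacobian (sq_add_sq_lt_one_of_mem_cylinderOver hB1 hv), abs_of_nonneg]
  positivity

lemma measurable_inv_norm_smul {n : ℕ} :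
    Measurable fun x : EuclideanSpace ℝ (Fin n) => ‖x‖⁻¹ • x := by
  fun_prop

lemma smul_map_diskToSphere_eq_map_normalize :
    ENNReal.ofReal (4 / 3) • (volume.restrict (ball 0 1)).map diskToSphere =
      (volume.restrict (ball (0 : EuclideanSpace ℝ (Fin 3)) 1)).map fun x => ‖x‖⁻¹ • x := by
  have hfin2 : IsFiniteMeasure ((volume : Measure (EuclideanSpace ℝ (Fin 2))).restrict
      (ball 0 1)) := ⟨by simp⟩
  have hfin : IsFiniteMeasure (ENNReal.ofReal (4 / 3) •
      ((volume : Measure (EuclideanSpace ℝ (Fin 2))).restrict (ball 0 1)).map diskToSphere) :=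
    Measure.smul_finite _ ENNReal.ofReal_ne_top
  refine Measure.eq_of_le_of_measure_univ_eq (Measure.le_iff.2 fun A hA => ?_) ?_
  · have hB : MeasurableSet (diskToSphere ⁻¹' A ∩ ball 0 1) :=
      (measurable_diskToSphere hA).inter measurableSet_ball
    rw [Measure.smul_apply, Measure.map_apply measurable_diskToSphere hA,
      Measure.map_apply measurable_inv_norm_smul hA,
      Measure.restrict_apply (measurable_diskToSphere hA),
      Measure.restrict_apply (measurable_inv_norm_smul hA), smul_eq_mul,
      ← volume_image_diskCone hB Set.inter_subset_right,
      ← (PiLp.volume_preserving_toLp (Fin 3)).measure_preimage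
        ((measurable_inv_norm_smul hA).inter measurableSet_ball).nullMeasurableSet]
    refine measure_mono ?_
    rintro _ ⟨v, hv, rfl⟩
    have hnorm : ‖v 0 • diskToSphere (!₂[v 1, v 2])‖ = v 0 := by
      rw [norm_smul, norm_diskToSphere hv.2.2, mul_one, Real.norm_of_nonneg hv.1.1.le]
    refine ⟨?_, ?_⟩
    · rw [Set.mem_preimage, toLp_diskCone, hnorm, inv_smul_smul₀ hv.1.1.ne']
      exact hv.2.1
    · rw [toLp_diskCone, mem_ball_zero_iff, hnorm]
      exact hv.1.2
  · rw [Measure.smul_apply, Measure.map_apply measurable_diskToSphere .univ,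
      Measure.map_apply measurable_inv_norm_smul .univ]
    simp only [Set.preimage_univ, Measure.restrict_apply_univ,
      EuclideanSpace.volume_ball_fin_two, EuclideanSpace.volume_ball_fin_three, smul_eq_mul,
      ENNReal.ofReal_one, one_pow, one_mul]
    rw [← ENNReal.ofReal_mul (by norm_num)]
    ring_nf

lemma map_normalize_map_linearIsometryEquiv {n : ℕ}
    (e : EuclideanSpace ℝ (Fin n) ≃ₗᵢ[ℝ] EuclideanSpace ℝ (Fin n)) :
    ((volume.restrict (ball (0 : EuclideanSpace ℝ (Fin n)) 1)).map fun x => ‖x‖⁻¹ • x).map e =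
      (volume.restrict (ball (0 : EuclideanSpace ℝ (Fin n)) 1)).map fun x => ‖x‖⁻¹ • x := by
  have he : Measurable e := e.continuous.measurable
  have hinv : (volume.restrict (ball (0 : EuclideanSpace ℝ (Fin n)) 1)).map e =
      volume.restrict (ball (0 : EuclideanSpace ℝ (Fin n)) 1) := by
    have h := (e.measurePreserving.restrict_preimage (measurableSet_ball (x := 0) (ε := 1))).map_eq
    rwa [e.preimage_ball, map_zero] at h
  have hcomm : (e ∘ fun x => ‖x‖⁻¹ • x) = (fun x => ‖x‖⁻¹ • x) ∘ e := by
    ext1 x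
    simp
  rw [Measure.map_map he measurable_inv_norm_smul, hcomm,
    ← Measure.map_map measurable_inv_norm_smul he, hinv]

lemma uniformBall_eq_ball {n : ℕ} [NeZero n] :
    uniformBall n = (volume (closedBall (0 : EuclideanSpace ℝ (Fin n)) 1))⁻¹ •
      volume.restrict (ball (0 : EuclideanSpace ℝ (Fin n)) 1) := by
  have h : (closedBall (0 : EuclideanSpace ℝ (Fin n)) 1 : Set _) =ᵐ[volume] ball 0 1 :=
    (ae_eq_of_subset_of_measure_ge ball_subset_closedBall
      (Measure.addHaar_closedBall_eq_addHaar_ball volume _ _).le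
      measurableSet_ball.nullMeasurableSet measure_closedBall_lt_top.ne).symm
  rw [uniformBall, Measure.restrict_congr_set h]

/-- correctness of Marsaglia's method for `n = 3`. If `(a, b)` is uniform
on the unit disk and `S = a² + b²`, then
`(a·√((1−(1−2S)²)/S), b·√((1−(1−2S)²)/S), 1−2S)` is uniform on `S² ⊂ ℝ³`. -/
theorem marsaglia_three_dim_uniform_on_sphere
    {Ω : Type*} [MeasureSpace Ω] [IsProbabilityMeasure (ℙ : Measure Ω)]
    (p : Ω → EuclideanSpace ℝ (Fin 2)) (hpmeas : Measurable p)
    (hp : Measure.map p ℙ = uniformBall 2)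
    (S : Ω → ℝ) (hS : ∀ ω, S ω = (p ω 0) ^ 2 + (p ω 1) ^ 2)
    (V : Ω → EuclideanSpace ℝ (Fin 3))
    (hV0 : ∀ ω, V ω 0 = p ω 0 * Real.sqrt ((1 - (1 - 2 * S ω) ^ 2) / S ω))
    (hV1 : ∀ ω, V ω 1 = p ω 1 * Real.sqrt ((1 - (1 - 2 * S ω) ^ 2) / S ω))
    (hV2 : ∀ ω, V ω 2 = 1 - 2 * S ω) :
    IsUniformSphere (Measure.map V ℙ) := by
  have hV : V = diskToSphere ∘ p := by
    have key (x s : ℝ) (hx : s = 0 → x = 0) :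
        x * √((1 - (1 - 2 * s) ^ 2) / s) = 2 * x * √(1 - s) := by
      rcases eq_or_ne s 0 with rfl | hs
      · simp [hx rfl]
      · have : (1 - (1 - 2 * s) ^ 2) / s = 2 ^ 2 * (1 - s) := by
          field_simp
          ring
        rw [this, Real.sqrt_mul (by norm_num), Real.sqrt_sq (by norm_num)]
        ring
    ext ω i
    fin_cases i
    · simp only [Fin.zero_eta, hV0, Function.comp_apply, diskToSphere, PiLp.toLp_apply,
        Matrix.cons_val, ← hS]
      exact key _ _ fun h => by nlinarith [hS ω, sq_nonneg (p ω 1)]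
    · simp only [Fin.mk_one, hV1, Function.comp_apply, diskToSphere, PiLp.toLp_apply,
        Matrix.cons_val, ← hS]
      exact key _ _ fun h => by nlinarith [hS ω, sq_nonneg (p ω 0)]
    · simp only [Fin.reduceFinMk, hV2, Function.comp_apply, diskToSphere, PiLp.toLp_apply,
        Matrix.cons_val, ← hS]
  have hmap : Measure.map V ℙ = (uniformBall 2).map diskToSphere := by
    rw [hV, ← Measure.map_map measurable_diskToSphere hpmeas, hp]
  refine ⟨?_, ?_, fun e => ?_⟩
  · rw [hV]
    exact Measure.isProbabilityMeasure_map (measurable_diskToSphere.comp hpmeas).aemeasurable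
  · have hsub : diskToSphere ⁻¹' (sphere 0 1)ᶜ ∩ ball 0 1 = ∅ := by
      ext x
      simp only [Set.mem_inter_iff, Set.mem_preimage, Set.mem_compl_iff, mem_sphere_zero_iff_norm,
        Set.mem_empty_iff_false, iff_false, not_and]
      exact fun h hx => h (norm_diskToSphere hx)
    have hm : MeasurableSet (sphere (0 : EuclideanSpace ℝ (Fin 3)) 1)ᶜ :=
      isClosed_sphere.measurableSet.compl
    rw [hmap, uniformBall_eq_ball, Measure.map_apply measurable_diskToSphere hm,
      Measure.smul_apply, Measure.restrict_apply (measurable_diskToSphere hm), hsub,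
      measure_empty, smul_zero]
  · have hc : ENNReal.ofReal (4 / 3) ≠ 0 := by simp
    have h := map_normalize_map_linearIsometryEquiv e
    rw [← smul_map_diskToSphere_eq_map_normalize, Measure.map_smul] at h
    have h' : ((volume.restrict (ball 0 1)).map diskToSphere).map e =
        (volume.restrict (ball 0 1)).map diskToSphere := by
      have := congrArg (fun μ => (ENNReal.ofReal (4 / 3))⁻¹ • μ) h
      simpa only [smul_smul, ENNReal.inv_mul_cancel hc ENNReal.ofReal_ne_top, one_smul] using this
    rw [hmap, uniformBall_eq_ball, Measure.map_smul, Measure.map_smul, h']
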